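/- Let G be a group and κ an infinite cardinal with κ ≤ |G|. The following conditions are equivalent: (1) the family 𝓔_{[G]^{<κ}} of entourages has a linearly ordered base, i.e., a subfamily linearly ordered by inclusion such that every entourage is contained in some member of it; (2) the family [G]^{<κ} of subsets of G of cardinality < κ has a subfamily linearly ordered by inclusion such that every set of cardinality < κ is contained in some member of it; (3) the ballean (G, 𝓔_{[G]^{<κ}}) has bounded growth; (4) |G| = κ and κ is a regular cardinal. Moreover, if κ is regular or the group G is solvable, then conditions (1)–(4) are also equivalent to: (5) the ballean (G, 𝓔_{[G]^{<κ}}) is normal. -/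

import Mathlib

universe u

open Set Pointwise

/-- For the ballean `(G, 𝓔_{[G]^{<κ}})`, sets `A, B ⊆ G` are asymptotically disjoint:
for every `I` of cardinality `< κ` the set `(A ∪ IA) ∩ (B ∪ IB)` has cardinality `< κ`. -/
def GrpAsympDisjoint {G : Type u} [Group G] (κ : Cardinal.{u}) (A B : Set G) : Prop :=
  ∀ I : Set G, Cardinal.mk ↥I < κ →
    Cardinal.mk ↥((A ∪ I * A) ∩ (B ∪ I * B)) < κ

/-- `U` is an asymptotic neighborhood of `A` in `(G, 𝓔_{[G]^{<κ}})`: for every `I` of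
cardinality `< κ` the set `(A ∪ IA) \ U` has cardinality `< κ`. -/
def GrpAsympNbhd {G : Type u} [Group G] (κ : Cardinal.{u}) (A U : Set G) : Prop :=
  ∀ I : Set G, Cardinal.mk ↥I < κ → Cardinal.mk ↥((A ∪ I * A) \ U) < κ

/-- (5) Normality of the ballean `(G, 𝓔_{[G]^{<κ}})`. -/
def GrpNormal (G : Type u) [Group G] (κ : Cardinal.{u}) : Prop :=
  ∀ A B : Set G, GrpAsympDisjoint κ A B →
    ∃ U V : Set G, GrpAsympNbhd κ A U ∧ GrpAsympNbhd κ B V ∧ Disjoint U V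

/-- The family of entourages `E_I = {(x,y) : y ∈ {x} ∪ Ix}`, `I ∈ [G]^{<κ}`. -/
def GrpEntFam (G : Type u) [Group G] (κ : Cardinal.{u}) : Set (Set (G × G)) :=
  {E | ∃ I : Set G, Cardinal.mk ↥I < κ ∧
    E = {p : G × G | p.2 = p.1 ∨ ∃ i ∈ I, p.2 = i * p.1}}

/-- (1) The family of entourages `𝓔_{[G]^{<κ}}` has a linearly ordered base. -/
def GrpEntLinBase (G : Type u) [Group G] (κ : Cardinal.{u}) : Prop :=
  ∃ 𝒞 : Set (Set (G × G)), 𝒞 ⊆ GrpEntFam G κ ∧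
    (∀ C ∈ 𝒞, ∀ D ∈ 𝒞, C ⊆ D ∨ D ⊆ C) ∧
    ∀ E ∈ GrpEntFam G κ, ∃ C ∈ 𝒞, E ⊆ C

/-- (2) The bornology `[G]^{<κ}` has a linearly ordered base. -/
def GrpBornLinBase (G : Type u) [Group G] (κ : Cardinal.{u}) : Prop :=
  ∃ 𝒞 : Set (Set G), (∀ C ∈ 𝒞, Cardinal.mk ↥C < κ) ∧
    (∀ C ∈ 𝒞, ∀ D ∈ 𝒞, C ⊆ D ∨ D ⊆ C) ∧
    ∀ S : Set G, Cardinal.mk ↥S < κ → ∃ C ∈ 𝒞, S ⊆ C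

/-- (3) The ballean `(G, 𝓔_{[G]^{<κ}})` has bounded growth. -/
def GrpBoundedGrowth (G : Type u) [Group G] (κ : Cardinal.{u}) : Prop :=
  ∃ Γ : Set (G × G),
    (∀ S : Set G, Cardinal.mk ↥S < κ →
      Cardinal.mk ↥{y : G | ∃ x ∈ S, (x, y) ∈ Γ} < κ) ∧
    ∀ I : Set G, Cardinal.mk ↥I < κ →
      ∃ S : Set G, Cardinal.mk ↥S < κ ∧
        ∀ x ∉ S, ({x} : Set G) ∪ I * {x} ⊆ {y : G | (x, y) ∈ Γ}


section helpers

open scoped Cardinal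

lemma aux_Iio {κ : Cardinal.{u}} (i : κ.ord.ToType) : #(Iio i) < κ := by
  simpa using Cardinal.mk_Iio_lt i

lemma aux_Iic {κ : Cardinal.{u}} (hκ : ℵ₀ ≤ κ) (i : κ.ord.ToType) : #(Iic i) < κ := by
  have h : Iic i ⊆ insert i (Iio i) := by
    intro j hj
    rcases eq_or_lt_of_le (show j ≤ i from hj) with h | h
    · exact Or.inl h
    · exact Or.inr h
  refine (Cardinal.mk_le_mk_of_subset h).trans_lt (Cardinal.mk_insert_le.trans_lt ?_)
  exact Cardinal.add_lt_of_lt hκ (aux_Iio i) (Cardinal.one_lt_aleph0.trans_le hκ)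

lemma aux_reg {κ : Cardinal.{u}} (hr : κ.IsRegular) (S : Set κ.ord.ToType) (hS : #S < κ) :
    ∃ a, ∀ i ∈ S, i < a := by
  by_contra! h
  have hc : IsCofinal S := fun a => by
    obtain ⟨i, hi, hai⟩ := h a
    exact ⟨i, hi, hai⟩
  have := Order.cof_le hc
  rw [Ordinal.cof_toType, hr.cof_ord] at this
  exact absurd this (not_le.2 hS)

lemma aux_sing {κ : Cardinal.{u}} (hκ : ℵ₀ ≤ κ) (hr : ¬ κ.IsRegular) :
    ∃ S : Set κ.ord.ToType, #S < κ ∧ ∀ i, ∃ j ∈ S, i ≤ j := by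
  obtain ⟨S, hS, hc⟩ := Order.exists_cof_eq κ.ord.ToType
  refine ⟨S, ?_, fun i => hS i⟩
  rw [hc, Ordinal.cof_toType]
  by_contra! h
  exact hr ⟨hκ, h⟩

lemma aux_sing_aleph0 {κ : Cardinal.{u}} (hκ : ℵ₀ ≤ κ) (hr : ¬ κ.IsRegular) : ℵ₀ < κ := by
  rcases eq_or_lt_of_le hκ with h | h
  · subst h
    exact absurd Cardinal.isRegular_aleph0 hr
  · exact h

lemma aux_sing_bound {κ : Cardinal.{u}} (hκ : ℵ₀ ≤ κ) (hr : ¬ κ.IsRegular) {X : Type u}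
    (m : X → Cardinal.{u})
    (hm : ∀ S : Set X, #S < κ → ∃ μ < κ, ∀ x ∈ S, m x ≤ μ) :
    ∃ μ < κ, ∀ x, m x ≤ μ := by
  by_contra! h
  obtain ⟨S, hS, hc⟩ := aux_sing hκ hr
  have h1 : ∀ j : κ.ord.ToType, ∃ x, (Ordinal.ToType.toOrd j).1.card < m x := fun j =>
    h _ (Cardinal.lt_ord.1 (Ordinal.ToType.toOrd j).2)
  choose f hf using h1
  obtain ⟨μ, hμ, hb⟩ := hm (f '' S) (Cardinal.mk_image_le.trans_lt hS)
  obtain ⟨j, hj, hij⟩ := hc (Ordinal.ToType.mk ⟨μ.ord, Cardinal.ord_lt_ord.2 hμ⟩)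
  have h2 := hb _ (mem_image_of_mem f hj)
  have h3 := (hf j).trans_le h2
  have h4 : (⟨μ.ord, Cardinal.ord_lt_ord.2 hμ⟩ : Iio κ.ord) ≤ Ordinal.ToType.toOrd j := by
    rw [← Ordinal.ToType.mk.le_symm_apply] at hij
    exact hij
  have h5 : μ.ord ≤ (Ordinal.ToType.toOrd j).1 := h4
  exact absurd (Cardinal.ord_le.1 h5) (not_le.2 h3)

lemma aux_succ_lt {κ μ : Cardinal.{u}} (hr : ¬ κ.IsRegular) (hμ : ℵ₀ ≤ μ)
    (h : μ < κ) : Order.succ μ < κ := by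
  rcases eq_or_lt_of_le (Order.succ_le_of_lt h) with h1 | h1
  · exact absurd (h1 ▸ Cardinal.isRegular_succ hμ) hr
  · exact h1

lemma aux_equiv {G : Type u} {κ : Cardinal.{u}} (h : #G = κ) : Nonempty (G ≃ κ.ord.ToType) := by
  rw [← Cardinal.eq, Cardinal.mk_ord_toType, h]

/-- `(4) → (2)` -/
lemma four_two {G : Type u} [Group G] {κ : Cardinal.{u}} (h : #G = κ) (hr : κ.IsRegular) :
    GrpBornLinBase G κ := by
  obtain ⟨r⟩ := aux_equiv h
  refine ⟨range fun i => r ⁻¹' (Iio i), ?_, ?_, ?_⟩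
  · rintro _ ⟨i, rfl⟩
    simp only []
    rw [Cardinal.mk_preimage_equiv]
    exact aux_Iio i
  · rintro _ ⟨i, rfl⟩ _ ⟨j, rfl⟩
    rcases le_total i j with h | h
    · exact Or.inl (preimage_mono (Iio_subset_Iio h))
    · exact Or.inr (preimage_mono (Iio_subset_Iio h))
  · intro S hS
    obtain ⟨a, ha⟩ := aux_reg hr (r '' S) (Cardinal.mk_image_le.trans_lt hS)
    exact ⟨_, ⟨a, rfl⟩, fun g hg => ha _ (mem_image_of_mem r hg)⟩

lemma two_one {G : Type u} [Group G] {κ : Cardinal.{u}} (h : GrpBornLinBase G κ) :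
    GrpEntLinBase G κ := by
  obtain ⟨C, h1, h2, h3⟩ := h
  refine ⟨(fun I : Set G => {p : G × G | p.2 = p.1 ∨ ∃ i ∈ I, p.2 = i * p.1}) '' C, ?_, ?_, ?_⟩
  · rintro _ ⟨I, hI, rfl⟩
    exact ⟨I, h1 I hI, rfl⟩
  · have key : ∀ I J : Set G, I ⊆ J → {p : G × G | p.2 = p.1 ∨ ∃ i ∈ I, p.2 = i * p.1} ⊆
        {p : G × G | p.2 = p.1 ∨ ∃ i ∈ J, p.2 = i * p.1} := by
      rintro I J hIJ p (hp | ⟨i, hi, hp⟩)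
      · exact Or.inl hp
      · exact Or.inr ⟨i, hIJ hi, hp⟩
    rintro _ ⟨I, hI, rfl⟩ _ ⟨J, hJ, rfl⟩
    rcases h2 I hI J hJ with h | h
    · exact Or.inl (key _ _ h)
    · exact Or.inr (key _ _ h)
  · rintro _ ⟨I, hI, rfl⟩
    obtain ⟨J, hJ, hIJ⟩ := h3 I hI
    refine ⟨_, ⟨J, hJ, rfl⟩, ?_⟩
    rintro p (hp | ⟨i, hi, hp⟩)
    · exact Or.inl hp
    · exact Or.inr ⟨i, hIJ hi, hp⟩

lemma one_two {G : Type u} [Group G] {κ : Cardinal.{u}} (hκ : ℵ₀ ≤ κ) (h : GrpEntLinBase G κ) :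
    GrpBornLinBase G κ := by
  obtain ⟨C, h1, h2, h3⟩ := h
  refine ⟨(fun E : Set (G × G) => {y | ((1 : G), y) ∈ E}) '' C, ?_, ?_, ?_⟩
  · rintro _ ⟨E, hE, rfl⟩
    obtain ⟨I, hI, rfl⟩ := h1 hE
    have : {y : G | ((1 : G), y) ∈ {p : G × G | p.2 = p.1 ∨ ∃ i ∈ I, p.2 = i * p.1}} ⊆
        insert 1 I := by
      rintro y (hy | ⟨i, hi, hy⟩)
      · exact Or.inl hy
      · right
        have : y = i := by simpa using hy
        exact this ▸ hi
    refine (Cardinal.mk_le_mk_of_subset this).trans_lt (Cardinal.mk_insert_le.trans_lt ?_)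
    exact Cardinal.add_lt_of_lt hκ hI (Cardinal.one_lt_aleph0.trans_le hκ)
  · rintro _ ⟨I, hI, rfl⟩ _ ⟨J, hJ, rfl⟩
    rcases h2 I hI J hJ with h | h
    · exact Or.inl (fun y hy => h hy)
    · exact Or.inr (fun y hy => h hy)
  · intro S hS
    obtain ⟨E, hE, h⟩ := h3 _ ⟨S, hS, rfl⟩
    refine ⟨_, ⟨E, hE, rfl⟩, fun y hy => h ?_⟩
    exact Or.inr ⟨y, hy, by simp⟩

lemma aux_compl {G : Type u} {κ : Cardinal.{u}} (hle : κ ≤ #G) {S : Set G} (hS : #S < κ) :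
    ∃ x, x ∉ S := by
  by_contra! h
  have : S = univ := eq_univ_of_forall h
  rw [this, Cardinal.mk_univ] at hS
  exact absurd hle (not_le.2 hS)

lemma two_four {G : Type u} [Group G] {κ : Cardinal.{u}} (hκ : ℵ₀ ≤ κ) (hle : κ ≤ #G)
    (h : GrpBornLinBase G κ) : #G = κ ∧ κ.IsRegular := by
  obtain ⟨C, h1, h2, h3⟩ := h
  obtain ⟨K, hK⟩ := Cardinal.le_mk_iff_exists_set.1 hle
  constructor
  · by_contra hne
    have hlt : κ < #G := lt_of_le_of_ne hle (Ne.symm hne)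
    have hs : ∀ x : G, ∃ D ∈ C, x ∈ D := fun x => by
      obtain ⟨D, hD, h⟩ := h3 {x} (by
        rw [Cardinal.mk_singleton]; exact Cardinal.one_lt_aleph0.trans_le hκ)
      exact ⟨D, hD, h rfl⟩
    choose D hD hxD using hs
    have hU : #(⋃ x : K, D x) ≤ κ := by
      refine (Cardinal.mk_iUnion_le _).trans ?_
      rw [hK]
      refine (mul_le_mul_right (ciSup_le' fun x : K => (h1 _ (hD x)).le) _).trans ?_
      rw [Cardinal.mul_eq_self hκ]
    obtain ⟨y, hy⟩ := aux_compl le_rfl (hU.trans_lt hlt)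
    have : K ⊆ D y := by
      intro x hx
      rcases h2 _ (hD x) _ (hD y) with h | h
      · exact h (hxD x)
      · exact absurd (mem_iUnion.2 ⟨⟨x, hx⟩, h (hxD y)⟩) hy
    have := Cardinal.mk_le_mk_of_subset this
    rw [hK] at this
    exact absurd this (not_le.2 (h1 _ (hD y)))
  · by_contra hr
    obtain ⟨S, hS, hc⟩ := aux_sing hκ hr
    obtain ⟨r⟩ := aux_equiv hK
    have hs : ∀ i : κ.ord.ToType, ∃ D ∈ C, ((fun j => ((r.symm j : K) : G)) '' Iic i) ⊆ D :=
      fun i => h3 _ (Cardinal.mk_image_le.trans_lt (aux_Iic hκ i))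
    choose D hD hxD using hs
    have hx : ∀ i, ∃ x, x ∉ D i := fun i => aux_compl hle (h1 _ (hD i))
    choose x hx using hx
    obtain ⟨E, hE, hxE⟩ := h3 (x '' S) (Cardinal.mk_image_le.trans_lt hS)
    have : K ⊆ E := by
      intro k hk
      obtain ⟨j, hj, hij⟩ := hc (r ⟨k, hk⟩)
      rcases h2 _ (hD j) _ hE with h | h
      · exact h (hxD j ⟨r ⟨k, hk⟩, hij, by simp⟩)
      · exact absurd (h (hxE (mem_image_of_mem x hj))) (hx j)
    have := Cardinal.mk_le_mk_of_subset this
    rw [hK] at this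
    exact absurd this (not_le.2 (h1 _ hE))

lemma four_three {G : Type u} [Group G] {κ : Cardinal.{u}} (h : #G = κ) (hr : κ.IsRegular) :
    GrpBoundedGrowth G κ := by
  obtain ⟨r⟩ := aux_equiv h
  have hκ := hr.aleph0_le
  refine ⟨{p | p.2 = p.1 ∨ r (p.2 * p.1⁻¹) ≤ r p.1}, ?_, ?_⟩
  · intro S hS
    have : {y : G | ∃ x ∈ S, (x, y) ∈ {p : G × G | p.2 = p.1 ∨ r (p.2 * p.1⁻¹) ≤ r p.1}} ⊆
        ⋃ x : S, insert x.1 ((fun i => r.symm i * x.1) '' Iic (r x.1)) := by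
      rintro y ⟨x, hx, hy⟩
      refine mem_iUnion.2 ⟨⟨x, hx⟩, ?_⟩
      rcases hy with hy | hy
      · exact Or.inl hy
      · refine Or.inr ⟨r (y * x⁻¹), hy, by simp⟩
    refine (Cardinal.mk_le_mk_of_subset this).trans_lt ?_
    rw [Cardinal.card_iUnion_lt_iff_forall_of_isRegular hr hS]
    intro x
    refine Cardinal.mk_insert_le.trans_lt ?_
    exact Cardinal.add_lt_of_lt hκ (Cardinal.mk_image_le.trans_lt (aux_Iic hκ _))
      (Cardinal.one_lt_aleph0.trans_le hκ)
  · intro I hI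
    obtain ⟨a, ha⟩ := aux_reg hr (r '' I) (Cardinal.mk_image_le.trans_lt hI)
    refine ⟨r ⁻¹' (Iio a), ?_, ?_⟩
    · rw [Cardinal.mk_preimage_equiv]
      exact aux_Iio a
    · rintro x hx y (hy | hy)
      · exact Or.inl hy
      · right
        obtain ⟨i, hi, z, hz, rfl⟩ := hy
        have hz : z = x := hz
        subst hz
        have := ha _ (mem_image_of_mem r hi)
        simp only [mem_preimage, mem_Iio, not_lt] at hx
        simpa using this.le.trans hx

lemma three_four {G : Type u} [Group G] {κ : Cardinal.{u}} (hκ : ℵ₀ ≤ κ) (hle : κ ≤ #G)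
    (h : GrpBoundedGrowth G κ) : #G = κ ∧ κ.IsRegular := by
  obtain ⟨Γ, h1, h2⟩ := h
  have hone : ∀ x : G, #({x} : Set G) < κ := fun x => by
    rw [Cardinal.mk_singleton]; exact Cardinal.one_lt_aleph0.trans_le hκ
  have hx1 : ∀ x : G, #{y | (x, y) ∈ Γ} < κ := fun x => by
    simpa using h1 {x} (hone x)
  constructor
  · by_contra hne
    have hlt : κ < #G := lt_of_le_of_ne hle (Ne.symm hne)
    obtain ⟨K, hK⟩ := Cardinal.le_mk_iff_exists_set.1 hle
    have hU : #(⋃ x : K, (fun y => y * x.1⁻¹) '' {y | (x.1, y) ∈ Γ}) ≤ κ := by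
      refine (Cardinal.mk_iUnion_le _).trans ?_
      rw [hK]
      refine (mul_le_mul_right (ciSup_le' fun x => 
        (Cardinal.mk_image_le.trans (hx1 _).le)) _).trans ?_
      rw [Cardinal.mul_eq_self hκ]
    obtain ⟨g, hg⟩ := aux_compl le_rfl (hU.trans_lt hlt)
    obtain ⟨S, hS, h⟩ := h2 {g} (hone g)
    have : K ⊆ S := by
      intro x hx
      by_contra hxS
      have := h x hxS (Or.inr ⟨g, rfl, x, rfl, rfl⟩ : g * x ∈ _)
      exact hg (mem_iUnion.2 ⟨⟨x, hx⟩, ⟨g * x, this, by simp⟩⟩)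
    have := Cardinal.mk_le_mk_of_subset this
    rw [hK] at this
    exact absurd this (not_le.2 hS)
  · by_contra hr
    obtain ⟨μ, hμ, hb⟩ := aux_sing_bound hκ hr (fun x : G => #{y | (x, y) ∈ Γ}) (by
      intro S hS
      refine ⟨_, h1 S hS, fun x hx => Cardinal.mk_le_mk_of_subset ?_⟩
      intro y hy
      exact ⟨x, hx, hy⟩)
    have hμ' : max μ ℵ₀ < κ := max_lt hμ (aux_sing_aleph0 hκ hr)
    have hsucc := aux_succ_lt hr (le_max_right _ _) hμ'
    obtain ⟨I, hI⟩ := Cardinal.le_mk_iff_exists_set.1 (hsucc.le.trans hle)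
    obtain ⟨S, hS, h⟩ := h2 I (hI ▸ hsucc)
    obtain ⟨x, hx⟩ := aux_compl hle hS
    have h3 : (fun i => i * x) '' I ⊆ {y | (x, y) ∈ Γ} := by
      rintro _ ⟨i, hi, rfl⟩
      exact h x hx (Or.inr ⟨i, hi, x, rfl, rfl⟩)
    have h4 := (Cardinal.mk_le_mk_of_subset h3).trans (hb x)
    rw [Cardinal.mk_image_eq (mul_left_injective x), hI] at h4
    exact absurd (h4.trans (le_max_left _ _)) (not_le.2 (Order.lt_succ _))

lemma four_five {G : Type u} [Group G] {κ : Cardinal.{u}} (h : #G = κ) (hr : κ.IsRegular) :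
    GrpNormal G κ := by
  obtain ⟨r⟩ := aux_equiv h
  have key : ∀ A B : Set G, GrpAsympDisjoint κ A B →
      GrpAsympNbhd κ A {y | ∃ g, g⁻¹ * y ∈ A ∧ ∀ h, h⁻¹ * y ∈ B → r g < r h} := by
    intro A B hAB I hI
    have hI1 : #(insert 1 I : Set G) < κ := Cardinal.mk_insert_le.trans_lt
      (Cardinal.add_lt_of_lt hr.aleph0_le hI (Cardinal.one_lt_aleph0.trans_le hr.aleph0_le))
    obtain ⟨a, ha⟩ := aux_reg hr (r '' (insert 1 I)) (Cardinal.mk_image_le.trans_lt hI1)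
    have hJ : #(r ⁻¹' (Iio a)) < κ := by
      rw [Cardinal.mk_preimage_equiv]
      exact aux_Iio a
    refine (Cardinal.mk_le_mk_of_subset ?_).trans_lt (hAB _ hJ)
    rintro y ⟨hy, hyU⟩
    have : ∃ i ∈ insert 1 I, i⁻¹ * y ∈ A := by
      rcases hy with hy | ⟨i, hi, z, hz, rfl⟩
      · exact ⟨1, Or.inl rfl, by simpa using hy⟩
      · exact ⟨i, Or.inr hi, by simpa using hz⟩
    obtain ⟨i, hi, hiA⟩ := this
    have hia := ha _ (mem_image_of_mem r hi)
    have : ∃ h, h⁻¹ * y ∈ B ∧ r h ≤ r i := by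
      by_contra! hcon
      exact hyU ⟨i, hiA, hcon⟩
    obtain ⟨h, hB, hhi⟩ := this
    refine ⟨Or.inr ⟨i, hia, _, hiA, by simp⟩, Or.inr ⟨h, hhi.trans_lt hia, _, hB, by simp⟩⟩
  intro A B hAB
  refine ⟨_, _, key A B hAB, key B A ?_, ?_⟩
  · intro I hI
    rw [inter_comm]
    exact hAB I hI
  · rw [Set.disjoint_left]
    rintro y ⟨g, hg, hg'⟩ ⟨h, hh, hh'⟩
    exact lt_asymm (hg' h hh) (hh' g hg)

lemma aux_closure {G : Type u} [Group G] {θ : Cardinal.{u}} (hθ : ℵ₀ < θ) {S : Set G}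
    (hS : #S < θ) : #(Subgroup.closure S : Set G) < θ := by
  rcases S.eq_empty_or_nonempty with rfl | hne
  · rw [Subgroup.closure_empty]
    simpa using Cardinal.one_lt_aleph0.trans hθ
  · haveI := hne.to_subtype
    rw [FreeGroup.closure_eq_range, MonoidHom.coe_range]
    refine Cardinal.mk_range_le.trans_lt ?_
    rw [Cardinal.mk_freeGroup]
    exact max_lt hS hθ

lemma aux_generic {G : Type u} [Group G] {θ : Cardinal.{u}} (hθ : ℵ₀ < θ) (hle : θ ≤ #G)
    (D : θ.ord.ToType → Set G) (hD : ∀ i, #(D i) < θ) :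
    ∃ x : θ.ord.ToType → G, ∀ i, x i ∉ Subgroup.closure (x '' Iio i ∪ D i) := by
  have ex : ∀ (i : θ.ord.ToType) (f : ∀ j, j < i → G),
      ∃ y, y ∉ (Subgroup.closure ((range fun j : Iio i => f j.1 j.2) ∪ D i) : Set G) := by
    intro i f
    refine aux_compl hle (aux_closure hθ ?_)
    refine (Cardinal.mk_union_le _ _).trans_lt (Cardinal.add_lt_of_lt hθ.le ?_ (hD i))
    exact Cardinal.mk_range_le.trans_lt (aux_Iio i)
  let x : θ.ord.ToType → G :=
    (wellFounded_lt (α := θ.ord.ToType)).fix fun i f => Classical.choose (ex i f)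
  refine ⟨x, fun i => ?_⟩
  have h1 : x i = Classical.choose (ex i fun j _ => x j) :=
    WellFounded.fix_eq _ _ _
  have h2 := Classical.choose_spec (ex i fun j _ => x j)
  rw [← h1] at h2
  have h3 : (range fun j : Iio i => x j.1) = x '' Iio i := by
    rw [image_eq_range]
  rw [h3] at h2
  exact h2

section core

variable {G : Type u} [Group G] {I : Type u} [LinearOrder I] {X S H : I → G}

lemma core_u1 (hX : ∀ i, X i ∉ Subgroup.closure (X '' Iio i ∪ (S '' Iic i ∪ H '' Iic i)))
    {a b c d : I} (E : (H a)⁻¹ * X a * (X b)⁻¹ * S b = (H c)⁻¹ * X c * (X d)⁻¹ * S d)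
    (hb : b < a) (hc : c < a) (hd : d < a) : False := by
  apply hX a
  have mX : ∀ j, j < a → X j ∈ Subgroup.closure (X '' Iio a ∪ (S '' Iic a ∪ H '' Iic a)) :=
    fun j hj => Subgroup.subset_closure (Or.inl (mem_image_of_mem X hj))
  have mS : ∀ j, j ≤ a → S j ∈ Subgroup.closure (X '' Iio a ∪ (S '' Iic a ∪ H '' Iic a)) :=
    fun j hj => Subgroup.subset_closure (Or.inr (Or.inl (mem_image_of_mem S hj)))
  have mH : ∀ j, j ≤ a → H j ∈ Subgroup.closure (X '' Iio a ∪ (S '' Iic a ∪ H '' Iic a)) :=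
    fun j hj => Subgroup.subset_closure (Or.inr (Or.inr (mem_image_of_mem H hj)))
  have e : X a = H a * ((H c)⁻¹ * X c * (X d)⁻¹ * S d) * (S b)⁻¹ * X b := by
    rw [← E]; group
  rw [e]
  exact mul_mem (mul_mem (mul_mem (mH _ le_rfl) (mul_mem (mul_mem (mul_mem
    (inv_mem (mH _ hc.le)) (mX _ hc)) (inv_mem (mX _ hd))) (mS _ hd.le)))
    (inv_mem (mS _ hb.le))) (mX _ hb)

lemma core_u2 (hX : ∀ i, X i ∉ Subgroup.closure (X '' Iio i ∪ (S '' Iic i ∪ H '' Iic i)))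
    {a b c d : I} (E : (H a)⁻¹ * X a * (X b)⁻¹ * S b = (H c)⁻¹ * X c * (X d)⁻¹ * S d)
    (ha : a < b) (hc : c < b) (hd : d < b) : False := by
  apply hX b
  have mX : ∀ j, j < b → X j ∈ Subgroup.closure (X '' Iio b ∪ (S '' Iic b ∪ H '' Iic b)) :=
    fun j hj => Subgroup.subset_closure (Or.inl (mem_image_of_mem X hj))
  have mS : ∀ j, j ≤ b → S j ∈ Subgroup.closure (X '' Iio b ∪ (S '' Iic b ∪ H '' Iic b)) :=
    fun j hj => Subgroup.subset_closure (Or.inr (Or.inl (mem_image_of_mem S hj)))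
  have mH : ∀ j, j ≤ b → H j ∈ Subgroup.closure (X '' Iio b ∪ (S '' Iic b ∪ H '' Iic b)) :=
    fun j hj => Subgroup.subset_closure (Or.inr (Or.inr (mem_image_of_mem H hj)))
  have e : X b = S b * ((H c)⁻¹ * X c * (X d)⁻¹ * S d)⁻¹ * (H a)⁻¹ * X a := by
    rw [← E]; group
  rw [e]
  exact mul_mem (mul_mem (mul_mem (mS _ le_rfl) (inv_mem (mul_mem (mul_mem (mul_mem
    (inv_mem (mH _ hc.le)) (mX _ hc)) (inv_mem (mX _ hd))) (mS _ hd.le))))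
    (inv_mem (mH _ ha.le))) (mX _ ha)

lemma ord_pair {α : Type*} [LinearOrder α] {a b c d : α} (u1 : b < a → c < a → d < a → False) (u2 : a < b → c < b → d < b → False) (u3 : d < c → a < c → b < c → False) (u4 : c < d → a < d → b < d → False) (hab : a ≠ b) (hcd : c ≠ d) (hac : a ≠ c) (hbd : b ≠ d) : (a = d ∧ b < a ∧ c < a) ∨ (c = b ∧ d < b ∧ a < b) := by
  rcases lt_or_gt_of_ne hab with h1 | h1 <;> rcases lt_or_gt_of_ne hcd with h2 | h2 <;> rcases lt_or_gt_of_ne hac with h3 | h3 <;> rcases lt_or_gt_of_ne hbd with h4 | h4 <;> rcases lt_trichotomy a d with h5 | h5 | h5 <;> rcases lt_trichotomy b c with h6 | h6 | h6 <;> grind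

lemma ord_four {α : Type*} [LinearOrder α] {a b c d : α} (u1 : b < a → c < a → d < a → False) (u2 : a < b → c < b → d < b → False) (u3 : d < c → a < c → b < c → False) (u4 : c < d → a < d → b < d → False) (hab : a ≠ b) (hcd : c ≠ d) (hac : a ≠ c) (hbd : b ≠ d) (had : a ≠ d) (hbc : b ≠ c) : False := by
  rcases lt_or_gt_of_ne hab with h1 | h1 <;> rcases lt_or_gt_of_ne hcd with h2 | h2 <;> rcases lt_or_gt_of_ne hac with h3 | h3 <;> rcases lt_or_gt_of_ne hbd with h4 | h4 <;> rcases lt_or_gt_of_ne had with h5 | h5 <;> rcases lt_or_gt_of_ne hbc with h6 | h6 <;> grind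

lemma core_pair (hX : ∀ i, X i ∉ Subgroup.closure (X '' Iio i ∪ (S '' Iic i ∪ H '' Iic i)))
    {a b c d : I} (E : (H a)⁻¹ * X a * (X b)⁻¹ * S b = (H c)⁻¹ * X c * (X d)⁻¹ * S d)
    (hab : a ≠ b) (hcd : c ≠ d) (hac : a ≠ c) (hbd : b ≠ d) :
    (a = d ∧ b < a ∧ c < a) ∨ (c = b ∧ d < b ∧ a < b) := by
  have u1 := core_u1 hX E
  have u2 := core_u2 hX E
  have u3 := core_u1 hX E.symm
  have u4 := core_u2 hX E.symm
  exact ord_pair u1 u2 u3 u4 hab hcd hac hbd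

lemma core_finite (hX : ∀ i, X i ∉ Subgroup.closure (X '' Iio i ∪ (S '' Iic i ∪ H '' Iic i)))
    (hinj : ∀ i j, (H i)⁻¹ * S i = (H j)⁻¹ * S j → i = j) (g : G) :
    {b | (∃ i, b = (H i)⁻¹ * X i) ∧ ∃ j, b = g * ((S j)⁻¹ * X j)}.Finite := by
  have h1 : {b | ∃ i, b = (H i)⁻¹ * X i ∧ b = g * ((S i)⁻¹ * X i)}.Finite := by
    apply Set.Subsingleton.finite
    rintro b ⟨i, hi, hi'⟩ c ⟨j, hj, hj'⟩
    have e1 : (H i)⁻¹ * S i = g := by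
      have h := hi.symm.trans hi'
      rw [← mul_assoc] at h
      have := mul_right_cancel h
      rw [this]; group
    have e2 : (H j)⁻¹ * S j = g := by
      have h := hj.symm.trans hj'
      rw [← mul_assoc] at h
      have := mul_right_cancel h
      rw [this]; group
    have := hinj i j (e1.trans e2.symm)
    rw [hi, hj, this]
  have h2 : {b | ∃ i j, i ≠ j ∧ b = (H i)⁻¹ * X i ∧ b = g * ((S j)⁻¹ * X j)}.Finite := by
    by_contra hinf
    obtain ⟨t, ht, hc⟩ := Set.Infinite.exists_subset_card_eq hinf 3
    classical
    obtain ⟨b1, b2, b3, h12, h13, h23, rfl⟩ := Finset.card_eq_three.1 hc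
    obtain ⟨i1, j1, n1, p1, q1⟩ := ht (by simp : b1 ∈ _)
    obtain ⟨i2, j2, n2, p2, q2⟩ := ht (by simp : b2 ∈ _)
    obtain ⟨i3, j3, n3, p3, q3⟩ := ht (by simp : b3 ∈ _)
    have e : ∀ {b i j}, b = (H i)⁻¹ * X i → b = g * ((S j)⁻¹ * X j) →
        (H i)⁻¹ * X i * (X j)⁻¹ * S j = g := by
      intro b i j h h'
      rw [← h, h']; group
    have ni : ∀ {b b' i i'}, b = (H i)⁻¹ * X i → b' = (H i')⁻¹ * X i' → b ≠ b' → i ≠ i' := by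
      rintro b b' i i' h h' hne rfl
      exact hne (h.trans h'.symm)
    have nj : ∀ {b b' j j'}, b = g * ((S j)⁻¹ * X j) → b' = g * ((S j')⁻¹ * X j') →
        b ≠ b' → j ≠ j' := by
      rintro b b' i i' h h' hne rfl
      exact hne (h.trans h'.symm)
    have A := core_pair hX ((e p1 q1).trans (e p2 q2).symm) n1 n2 (ni p1 p2 h12) (nj q1 q2 h12)
    have B := core_pair hX ((e p1 q1).trans (e p3 q3).symm) n1 n3 (ni p1 p3 h13) (nj q1 q3 h13)
    have C1 := ni p2 p3 h23
    have C2 := nj q2 q3 h23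
    grind
  refine (h1.union h2).subset ?_
  rintro b ⟨⟨i, hi⟩, ⟨j, hj⟩⟩
  by_cases hij : i = j
  · subst hij
    exact Or.inl ⟨i, hi, hj⟩
  · exact Or.inr ⟨i, j, hij, hi, hj⟩

lemma core_injective (hX : ∀ i, X i ∉ Subgroup.closure (X '' Iio i ∪ (S '' Iic i ∪ H '' Iic i))) :
    Function.Injective X := by
  have : ∀ i j, i < j → X i ≠ X j := by
    intro i j hij h
    apply hX j
    rw [← h]
    exact Subgroup.subset_closure (Or.inl (mem_image_of_mem X hij))
  intro i j h
  rcases lt_trichotomy i j with h' | h' | h'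
  · exact absurd h (this _ _ h')
  · exact h'
  · exact absurd h.symm (this _ _ h')

lemma core_four {e : I → G} (he : ∀ i, e i ∉ Subgroup.closure (e '' Iio i ∪ ∅))
    {a b c d : I} (E : (e a)⁻¹ * e b = (e c)⁻¹ * e d) (hab : a ≠ b) (hac : a ≠ c) (had : a ≠ d)
    (hbc : b ≠ c) (hbd : b ≠ d) (hcd : c ≠ d) : False := by
  have key : ∀ {i p q r : I}, e i = e p * (e q)⁻¹ * e r → p < i → q < i → r < i → False := by
    intro i p q r h hp hq hr
    apply he i
    rw [h]
    have m : ∀ j, j < i → e j ∈ Subgroup.closure (e '' Iio i ∪ ∅) :=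
      fun j hj => Subgroup.subset_closure (Or.inl (mem_image_of_mem e hj))
    exact mul_mem (mul_mem (m _ hp) (inv_mem (m _ hq))) (m _ hr)
  have k1 : e b = e a * (e c)⁻¹ * e d := by rw [mul_assoc, ← E]; group
  have k2 : e d = e c * (e a)⁻¹ * e b := by rw [mul_assoc, E]; group
  have k3 : e a = e b * (e d)⁻¹ * e c := by rw [k2]; group
  have k4 : e c = e d * (e b)⁻¹ * e a := by rw [k1]; group
  exact ord_four (fun x y z => @key _ _ _ _ k3 x z y) (@key _ _ _ _ k1)
    (fun x y z => @key _ _ _ _ k4 x z y) (@key _ _ _ _ k2) hab hcd hac hbd had hbc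

end core

lemma aux_matrix {G : Type u} [Group G] {θ : Cardinal.{u}} (hθ : ℵ₀ < θ) (hle : θ ≤ #G) :
    ∃ (s h : θ.ord.ToType → G) (x : θ.ord.ToType × θ.ord.ToType → G), Function.Injective x ∧
      ∀ g, {b | (∃ p, b = (h p.2)⁻¹ * x p) ∧ ∃ p, b = g * ((s p.1)⁻¹ * x p)}.Finite := by
  obtain ⟨e, he⟩ := aux_generic hθ hle (fun _ => ∅) (fun _ => by
    rw [Cardinal.mk_emptyCollection]; exact Cardinal.aleph0_pos.trans hθ)
  obtain ⟨ψ⟩ : Nonempty (θ.ord.ToType ⊕ θ.ord.ToType ≃ θ.ord.ToType) := by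
    rw [← Cardinal.eq, Cardinal.mk_sum, Cardinal.lift_id, Cardinal.mk_ord_toType,
      Cardinal.add_eq_self hθ.le]
  obtain ⟨φ⟩ : Nonempty (θ.ord.ToType ≃ θ.ord.ToType × θ.ord.ToType) := by
    rw [← Cardinal.eq, Cardinal.mk_prod, Cardinal.lift_id, Cardinal.mk_ord_toType,
      Cardinal.mul_eq_self hθ.le]
  let s : θ.ord.ToType → G := fun t => e (ψ (Sum.inl t))
  let h : θ.ord.ToType → G := fun t => e (ψ (Sum.inr t))
  let S : θ.ord.ToType → G := fun i => s (φ i).1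
  let H : θ.ord.ToType → G := fun i => h (φ i).2
  obtain ⟨X, hX⟩ := aux_generic hθ hle (fun i => S '' Iic i ∪ H '' Iic i) (fun i =>
    (Cardinal.mk_union_le _ _).trans_lt (Cardinal.add_lt_of_lt hθ.le
      (Cardinal.mk_image_le.trans_lt (aux_Iic hθ.le i))
      (Cardinal.mk_image_le.trans_lt (aux_Iic hθ.le i))))
  have hinj0 : ∀ a b c d, (h b)⁻¹ * s a = (h d)⁻¹ * s c → (a, b) = (c, d) := by
    have einj : Function.Injective e := by
      have : ∀ i j, i < j → e i ≠ e j := by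
        intro i j hij h
        apply he j
        rw [← h]
        exact Subgroup.subset_closure (Or.inl (mem_image_of_mem e hij))
      intro i j h
      rcases lt_trichotomy i j with h' | h' | h'
      · exact absurd h (this _ _ h')
      · exact h'
      · exact absurd h.symm (this _ _ h')
    intro a b c d E
    by_cases hac : a = c
    · subst hac
      have h1 := inv_injective (mul_right_cancel E)
      have h2 := Sum.inr_injective (ψ.injective (einj h1))
      rw [h2]
    by_cases hbd : b = d
    · subst hbd
      have h1 := mul_left_cancel E
      have h2 := Sum.inl_injective (ψ.injective (einj h1))
      rw [h2]
    exfalso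
    refine core_four he E ?_ ?_ ?_ ?_ ?_ ?_ <;> simp [hac, hbd]
  have hinj : ∀ i j, (H i)⁻¹ * S i = (H j)⁻¹ * S j → i = j := by
    intro i j hij
    have := hinj0 _ _ _ _ hij
    exact φ.injective this
  refine ⟨s, h, X ∘ φ.symm, (core_injective hX).comp φ.symm.injective, fun g => ?_⟩
  refine (core_finite hX hinj g).subset ?_
  rintro b ⟨⟨p, hp⟩, ⟨q, hq⟩⟩
  refine ⟨⟨φ.symm p, ?_⟩, ⟨φ.symm q, ?_⟩⟩
  · simpa [H] using hp
  · simpa [S] using hq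

lemma aux_iUnion_finite {κ : Cardinal.{u}} (hκ : ℵ₀ ≤ κ) {ι α : Type u} (hι : #ι < κ)
    (f : ι → Set α) (hf : ∀ i, (f i).Finite) : #(⋃ i, f i) < κ := by
  rcases lt_or_ge #ι ℵ₀ with h | h
  · haveI := Cardinal.lt_aleph0_iff_finite.1 h
    exact (Cardinal.lt_aleph0_iff_set_finite.2 (Set.finite_iUnion hf)).trans_le hκ
  · refine lt_of_le_of_lt ?_ hι
    refine (Cardinal.mk_iUnion_le _).trans ?_
    refine (mul_le_mul_right (ciSup_le' fun i =>
      (Cardinal.lt_aleph0_iff_set_finite.2 (hf i)).le) _).trans ?_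
    rw [Cardinal.mul_aleph0_eq h]

lemma aux_disjoint {G : Type u} [Group G] {κ : Cardinal.{u}} (hκ : ℵ₀ ≤ κ) (A B : Set G)
    (hAB : ∀ g, {b | b ∈ B ∧ ∃ a ∈ A, b = g * a}.Finite) : GrpAsympDisjoint κ A B := by
  intro I hI
  have hI1 : #(insert 1 I : Set G) < κ := Cardinal.mk_insert_le.trans_lt
    (Cardinal.add_lt_of_lt hκ hI (Cardinal.one_lt_aleph0.trans_le hκ))
  have hp : #((insert 1 I : Set G) × (insert 1 I : Set G)) < κ := by
    rw [Cardinal.mk_prod, Cardinal.lift_id]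
    exact Cardinal.mul_lt_of_lt hκ hI1 hI1
  refine (Cardinal.mk_le_mk_of_subset ?_).trans_lt (aux_iUnion_finite hκ hp
    (fun p => (fun b => p.2.1 * b) '' {b | b ∈ B ∧ ∃ a ∈ A, b = (p.2.1⁻¹ * p.1.1) * a})
    (fun p => (hAB _).image _))
  have key : ∀ (C : Set G) y, y ∈ C ∪ I * C → ∃ i ∈ (insert 1 I : Set G), ∃ c ∈ C, y = i * c := by
    rintro C y (hy | ⟨i, hi, c, hc, rfl⟩)
    · exact ⟨1, Or.inl rfl, y, hy, by simp⟩
    · exact ⟨i, Or.inr hi, c, hc, rfl⟩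
  rintro y ⟨h1, h2⟩
  obtain ⟨i, hi, a, ha, rfl⟩ := key _ _ h1
  obtain ⟨j, hj, b, hb, h⟩ := key _ _ h2
  refine mem_iUnion.2 ⟨(⟨i, hi⟩, ⟨j, hj⟩), b, ⟨hb, a, ha, ?_⟩, h.symm⟩
  simp only []
  rw [mul_assoc, h]; group

/-- The consequences of normality for the matrix. -/
lemma aux_normal {G : Type u} [Group G] {κ θ : Cardinal.{u}} (hκ : ℵ₀ ≤ κ)
    (hθ : ℵ₀ < θ) (hle : θ ≤ #G) (hn : GrpNormal G κ) :
    ∃ P : θ.ord.ToType → θ.ord.ToType → Prop,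
      (∀ J : Set θ.ord.ToType, #J < κ →
        #{p : θ.ord.ToType × θ.ord.ToType | p.1 ∈ J ∧ ¬ P p.1 p.2} < κ) ∧
      (∀ J : Set θ.ord.ToType, #J < κ →
        #{p : θ.ord.ToType × θ.ord.ToType | p.2 ∈ J ∧ P p.1 p.2} < κ) := by
  obtain ⟨s, h, x, hx, hf⟩ := aux_matrix hθ hle
  obtain ⟨U, V, hU, hV, hUV⟩ := hn (range fun p => (s p.1)⁻¹ * x p) (range fun p => (h p.2)⁻¹ * x p)
    (aux_disjoint hκ _ _ (by
      intro g
      refine (hf g).subset ?_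
      rintro b ⟨⟨p, hp⟩, _, ⟨q, rfl⟩, hq⟩
      exact ⟨⟨p, hp.symm⟩, ⟨q, hq⟩⟩))
  refine ⟨fun t a => x (t, a) ∈ U, ?_, ?_⟩
  · intro J hJ
    have := hU (s '' J) (Cardinal.mk_image_le.trans_lt hJ)
    refine lt_of_le_of_lt ?_ this
    rw [← Cardinal.mk_image_eq hx]
    apply Cardinal.mk_le_mk_of_subset
    rintro _ ⟨p, ⟨hp1, hp2⟩, rfl⟩
    exact ⟨Or.inr ⟨s p.1, mem_image_of_mem s hp1, _, ⟨p, rfl⟩, by simp⟩, hp2⟩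
  · intro J hJ
    have := hV (h '' J) (Cardinal.mk_image_le.trans_lt hJ)
    refine lt_of_le_of_lt ?_ this
    rw [← Cardinal.mk_image_eq hx]
    apply Cardinal.mk_le_mk_of_subset
    rintro _ ⟨p, ⟨hp1, hp2⟩, rfl⟩
    exact ⟨Or.inr ⟨h p.2, mem_image_of_mem h hp1, _, ⟨p, rfl⟩, by simp⟩,
      Set.disjoint_left.1 hUV hp2⟩

lemma aux_row {T : Type u} {ν : Cardinal.{u}} (hν : ℵ₀ ≤ ν) (hT : ν < #T) (P : T → T → Prop)
    (hP : ∀ a, #{t | P t a} ≤ ν) : ∃ t, ν ≤ #{a | ¬ P t a} := by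
  obtain ⟨C, hC⟩ := Cardinal.le_mk_iff_exists_set.1 hT.le
  have hU : #(⋃ a : C, {t | P t a}) ≤ ν := by
    refine (Cardinal.mk_iUnion_le _).trans ?_
    rw [hC]
    refine (mul_le_mul_right (ciSup_le' fun a : C => hP a) _).trans ?_
    rw [Cardinal.mul_eq_self hν]
  obtain ⟨t, ht⟩ := aux_compl le_rfl (hU.trans_lt hT)
  refine ⟨t, ?_⟩
  rw [← hC]
  apply Cardinal.mk_le_mk_of_subset
  intro a ha hP'
  exact ht (mem_iUnion.2 ⟨⟨a, ha⟩, hP'⟩)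

lemma five_four {G : Type u} [Group G] {κ : Cardinal.{u}} (hκ : ℵ₀ ≤ κ) (hle : κ ≤ #G)
    (hn : GrpNormal G κ) : #G = κ ∧ κ.IsRegular := by
  have hone : ∀ {T : Type u} (x : T), #({x} : Set T) < κ := fun x => by
    rw [Cardinal.mk_singleton]; exact Cardinal.one_lt_aleph0.trans_le hκ
  have row : ∀ {T : Type u} (Q : T × T → Prop) (J : Set T) (t : T), t ∈ J →
      #{a | Q (t, a)} ≤ #{p : T × T | p.1 ∈ J ∧ Q p} := by
    intro T Q J t ht
    rw [← Cardinal.mk_image_eq (f := fun a => (t, a)) (fun a b hab => (Prod.mk.inj hab).2)]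
    apply Cardinal.mk_le_mk_of_subset
    rintro _ ⟨a, ha, rfl⟩
    exact ⟨ht, ha⟩
  have col : ∀ {T : Type u} (Q : T × T → Prop) (J : Set T) (t : T), t ∈ J →
      #{a | Q (a, t)} ≤ #{p : T × T | p.2 ∈ J ∧ Q p} := by
    intro T Q J t ht
    rw [← Cardinal.mk_image_eq (f := fun a => (a, t)) (fun a b hab => (Prod.mk.inj hab).1)]
    apply Cardinal.mk_le_mk_of_subset
    rintro _ ⟨a, ha, rfl⟩
    exact ⟨ht, ha⟩
  by_cases hG : #G = κ
  · refine ⟨hG, ?_⟩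
    by_contra hr
    have hκ0 := aux_sing_aleph0 hκ hr
    obtain ⟨P, h1, h2⟩ := aux_normal hκ hκ0 hle hn
    obtain ⟨μ, hμ, hb⟩ := aux_sing_bound hκ hr (fun t => #{a | ¬ P t a}) (fun J hJ =>
      ⟨_, h1 J hJ, fun t ht => row (fun p => ¬ P p.1 p.2) J t ht⟩)
    obtain ⟨μ', hμ', hb'⟩ := aux_sing_bound hκ hr (fun a => #{t | P t a}) (fun J hJ =>
      ⟨_, h2 J hJ, fun t ht => col (fun p => P p.1 p.2) J t ht⟩)
    have hm : max (max μ μ') ℵ₀ < κ := max_lt (max_lt hμ hμ') hκ0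
    have hs := aux_succ_lt hr (le_max_right _ _) hm
    have hls : max (max μ μ') ℵ₀ < Order.succ (max (max μ μ') ℵ₀) := Order.lt_succ _
    obtain ⟨t, ht⟩ := aux_row ((le_max_right _ _).trans hls.le)
      (by rwa [Cardinal.mk_ord_toType]) P (fun a => (hb' a).trans
        (((le_max_right _ _).trans (le_max_left _ _)).trans hls.le))
    have := ht.trans ((hb t).trans ((le_max_left μ μ').trans (le_max_left _ ℵ₀)))
    exact absurd this (not_le.2 hls)
  · exfalso
    have hlt : κ < #G := lt_of_le_of_ne hle (Ne.symm hG)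
    have hls : κ < Order.succ κ := Order.lt_succ _
    obtain ⟨P, h1, h2⟩ := aux_normal hκ (hκ.trans_lt hls) (Order.succ_le_of_lt hlt) hn
    obtain ⟨t, ht⟩ := aux_row hκ (by rwa [Cardinal.mk_ord_toType]) P (fun a =>
      (col (fun p => P p.1 p.2) {a} a rfl).trans (h2 _ (hone a)).le)
    have := ht.trans ((row (fun p => ¬ P p.1 p.2) {t} t rfl))
    exact absurd this (not_le.2 (h1 _ (hone t)))

end helpers

/-- STATEMENT 10: for a group `G` and an infinite cardinal `κ ≤ |G|`, conditions
(1) `𝓔_{[G]^{<κ}}` has a linearly ordered base, (2) the bornology `[G]^{<κ}` has a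
linearly ordered base, (3) the ballean `(G, 𝓔_{[G]^{<κ}})` has bounded growth, and
(4) `|G| = κ` and `κ` is regular, are all equivalent; moreover, if `κ` is regular or
`G` is solvable, they are equivalent to (5) the ballean `(G, 𝓔_{[G]^{<κ}})` is normal. -/
theorem statement10 {G : Type u} [Group G] (κ : Cardinal.{u})
    (hκ : Cardinal.aleph0 ≤ κ) (hle : κ ≤ Cardinal.mk G) :
    (GrpEntLinBase G κ ↔ (Cardinal.mk G = κ ∧ κ.IsRegular)) ∧
    (GrpBornLinBase G κ ↔ (Cardinal.mk G = κ ∧ κ.IsRegular)) ∧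
    (GrpBoundedGrowth G κ ↔ (Cardinal.mk G = κ ∧ κ.IsRegular)) ∧
    ((κ.IsRegular ∨ IsSolvable G) →
      (GrpNormal G κ ↔ (Cardinal.mk G = κ ∧ κ.IsRegular))) := by

  refine ⟨⟨fun h => two_four hκ hle (one_two hκ h), fun h => two_one (four_two h.1 h.2)⟩,
    ⟨two_four hκ hle, fun h => four_two h.1 h.2⟩,
    ⟨three_four hκ hle, fun h => four_three h.1 h.2⟩,
    fun _ => ⟨five_four hκ hle, fun h => four_five h.1 h.2⟩⟩
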